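/- Let q = p^h with p > 3 prime, q ≡ 1 (mod 3) and q > 6.3·4^(13/3), and let f1, f2, f3 ∈ F_q[X,Y,Z] have degree 3 and satisfy f_i(0,0,0) = 0. Suppose the polynomial F splits into two quadrics switched by the Frobenius: there exist ξ ∈ F_{q^2} \ F_q and polynomials R, S ∈ F_q[X1,...,X6] of total degree at most 2 with max(deg R, deg S) = 2 such that F = (R + ξS)·(R + ξ^q S) in F_{q^2}[X1,...,X6]. Then the ovoid condition fails, i.e., O_7(f1,f2,f3) is not an ovoid of Q. -/

import Mathlib

open MvPolynomial

/-- The ovoid condition for `O_7(f1,f2,f3)`. -/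
def ovoidCondition {F : Type*} [Field F] (f1 f2 f3 : F → F → F → F) : Prop :=
  ∀ x1 y1 z1 x2 y2 z2 : F, (x1, y1, z1) ≠ (x2, y2, z2) →
    (x1 - x2) * (f3 x2 y2 z2 - f3 x1 y1 z1) +
      (y1 - y2) * (f2 x2 y2 z2 - f2 x1 y1 z1) +
      (z1 - z2) * (f1 x2 y2 z2 - f1 x1 y1 z1) ≠ 0

/-- The polynomial `F ∈ F_q[X1,...,X6]` (variables indexed `0,...,5`) defining the
hypersurface `S_{f1,f2,f3}` associated with `O_7(f1,f2,f3)`. -/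
noncomputable def polyF {F : Type*} [CommRing F] (f1 f2 f3 : MvPolynomial (Fin 3) F) :
    MvPolynomial (Fin 6) F :=
  (X 0 - X 3) *
      (aeval ![(X 3 : MvPolynomial (Fin 6) F), X 4, X 5] f3 -
        aeval ![(X 0 : MvPolynomial (Fin 6) F), X 1, X 2] f3) +
    (X 1 - X 4) *
      (aeval ![(X 3 : MvPolynomial (Fin 6) F), X 4, X 5] f2 -
        aeval ![(X 0 : MvPolynomial (Fin 6) F), X 1, X 2] f2) +
    (X 2 - X 5) *
      (aeval ![(X 3 : MvPolynomial (Fin 6) F), X 4, X 5] f1 -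
        aeval ![(X 0 : MvPolynomial (Fin 6) F), X 1, X 2] f1)

/-- Substitution of the generic point `T • a` of the line through `0` and `a`. -/
noncomputable def restrictLine {K σ : Type*} [Field K] (a : σ → K) :
    MvPolynomial σ K →ₐ[K] Polynomial K :=
  aeval fun i => Polynomial.C (a i) * Polynomial.X

theorem eval_one_restrictLine {K σ : Type*} [Field K] (a : σ → K) (p : MvPolynomial σ K) :
    (restrictLine a p).eval 1 = eval a p := by
  induction p using MvPolynomial.induction_on <;> simp_all [restrictLine]

theorem restrictLine_map {K L σ : Type*} [Field K] [Field L] (φ : K →+* L) (a : σ → K)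
    (p : MvPolynomial σ K) :
    restrictLine (fun i => φ (a i)) (map φ p) = (restrictLine a p).map φ := by
  induction p using MvPolynomial.induction_on <;> simp_all [restrictLine]

theorem restrictLine_mul_left {K σ : Type*} [Field K] (x : K) (a : σ → K)
    (p : MvPolynomial σ K) :
    restrictLine (fun i => x * a i) p =
      (restrictLine a p).comp (Polynomial.C x * Polynomial.X) := by
  induction p using MvPolynomial.induction_on <;>
    simp_all [restrictLine, mul_assoc, mul_left_comm]

theorem restrictLine_monomial_toFinsupp {K σ : Type*} [Field K] [DecidableEq σ] (a : σ → K)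
    (m : Multiset σ) (k : K) :
    restrictLine a (monomial (Multiset.toFinsupp m) k) =
      Polynomial.C k * (m.map fun i => Polynomial.C (a i) * Polynomial.X).prod := by
  induction m using Multiset.induction_on with
  | empty =>
    rw [map_zero, Multiset.map_zero, Multiset.prod_zero, mul_one]
    exact aeval_C (fun i => Polynomial.C (a i) * Polynomial.X) k
  | cons i m ih =>
    rw [← Multiset.singleton_add, map_add, Multiset.toFinsupp_singleton, monomial_single_add,
      map_mul, ih]
    simp [restrictLine, mul_left_comm]

theorem exists_restrictLine_monomial_eq {K σ : Type*} [Field K] (s : σ →₀ ℕ) (k : K)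
    (hs : s.degree ≤ 2) :
    ∃ (B : (σ → K) →ₗ[K] (σ → K) →ₗ[K] K) (ℓ : (σ → K) →ₗ[K] K) (c : K), ∀ a : σ → K,
      restrictLine a (monomial s k) = Polynomial.C (B a a) * Polynomial.X ^ 2 +
        Polynomial.C (ℓ a) * Polynomial.X + Polynomial.C c := by
  classical
  obtain ⟨m, rfl⟩ := Multiset.toFinsupp.surjective s
  have hm : m.card ≤ 2 := by
    rw [← Multiset.toFinsupp_sum_eq]
    exact hs
  simp only [restrictLine_monomial_toFinsupp]
  interval_cases h : m.card
  · obtain rfl := Multiset.card_eq_zero.1 h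
    exact ⟨0, 0, k, fun a => by simp⟩
  · obtain ⟨i, rfl⟩ := Multiset.card_eq_one.1 h
    exact ⟨0, k • LinearMap.proj i, 0, fun a => by simp; ring⟩
  · obtain ⟨i, j, rfl⟩ := Multiset.card_eq_two.1 h
    refine ⟨k • (LinearMap.mul K K).compl₁₂ (LinearMap.proj i) (LinearMap.proj j), 0, 0,
      fun a => ?_⟩
    simp
    ring

/-- A polynomial of degree at most two is the sum of a quadratic form, a linear form and a
constant. -/
theorem exists_restrictLine_eq {K σ : Type*} [Field K] (p : MvPolynomial σ K)
    (hp : p.totalDegree ≤ 2) :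
    ∃ (B : (σ → K) →ₗ[K] (σ → K) →ₗ[K] K) (ℓ : (σ → K) →ₗ[K] K) (c : K), ∀ a : σ → K,
      restrictLine a p = Polynomial.C (B a a) * Polynomial.X ^ 2 +
        Polynomial.C (ℓ a) * Polynomial.X + Polynomial.C c := by
  choose B ℓ c h using fun s : p.support =>
    exists_restrictLine_monomial_eq (s : σ →₀ ℕ) (p.coeff s)
      ((le_totalDegree s.2).trans hp)
  refine ⟨∑ s, B s, ∑ s, ℓ s, ∑ s, c s, fun a => ?_⟩
  conv_lhs => rw [p.as_sum, ← Finset.sum_coe_sort]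
  simp only [map_sum, h, Finset.sum_add_distrib, LinearMap.sum_apply, Finset.sum_mul]

/-- The point `(x, y)` of the product of two copies of the space. -/
def joinPoints {K : Type*} (x y : Fin 3 → K) : Fin 6 → K :=
  ![x 0, x 1, x 2, y 0, y 1, y 2]

theorem joinPoints_smul_self {K : Type*} [Field K] (x : K) (u : Fin 3 → K) :
    joinPoints (fun i => x * u i) u = x • joinPoints u 0 + joinPoints 0 u := by
  ext i
  fin_cases i <;> simp [joinPoints]

theorem restrictLine_polyF {K : Type*} [Field K] (f1 f2 f3 : MvPolynomial (Fin 3) K)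
    (x y : Fin 3 → K) :
    restrictLine (joinPoints x y) (polyF f1 f2 f3) =
      Polynomial.C (x 0 - y 0) * Polynomial.X * (restrictLine y f3 - restrictLine x f3) +
      Polynomial.C (x 1 - y 1) * Polynomial.X * (restrictLine y f2 - restrictLine x f2) +
      Polynomial.C (x 2 - y 2) * Polynomial.X * (restrictLine y f1 - restrictLine x f1) := by
  have hy (f : MvPolynomial (Fin 3) K) : restrictLine (joinPoints x y)
      (aeval ![(X 3 : MvPolynomial (Fin 6) K), X 4, X 5] f) = restrictLine y f := by
    rw [← AlgHom.comp_apply]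
    congr 1
    ext i : 1
    fin_cases i <;> simp [restrictLine, joinPoints]
  have hx (f : MvPolynomial (Fin 3) K) : restrictLine (joinPoints x y)
      (aeval ![(X 0 : MvPolynomial (Fin 6) K), X 1, X 2] f) = restrictLine x f := by
    rw [← AlgHom.comp_apply]
    congr 1
    ext i : 1
    fin_cases i <;> simp [restrictLine, joinPoints]
  simp only [polyF, map_add, map_mul, map_sub, hx, hy]
  simp [restrictLine, joinPoints]
  ring

theorem coeff_four_restrictLine_polyF {K : Type*} [Field K]
    (f1 f2 f3 : MvPolynomial (Fin 3) K) {x : K} (hx : x ^ 3 = 1) (u : Fin 3 → K) :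
    (restrictLine (joinPoints (fun i => x * u i) u) (polyF f1 f2 f3)).coeff 4 = 0 := by
  have h (f : MvPolynomial (Fin 3) K) : (restrictLine (fun i => x * u i) f).coeff 3 =
      (restrictLine u f).coeff 3 := by
    rw [restrictLine_mul_left, Polynomial.comp_C_mul_X_coeff, hx, mul_one]
  simp only [restrictLine_polyF, mul_assoc, Polynomial.coeff_add, Polynomial.coeff_C_mul,
    Polynomial.coeff_X_mul, Polynomial.coeff_sub, h, sub_self, mul_zero, add_zero]

theorem eval_joinPoints_polyF {K : Type*} [Field K] (f1 f2 f3 : MvPolynomial (Fin 3) K)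
    (x y : Fin 3 → K) :
    eval (joinPoints x y) (polyF f1 f2 f3) =
      (x 0 - y 0) * (eval y f3 - eval x f3) + (x 1 - y 1) * (eval y f2 - eval x f2) +
        (x 2 - y 2) * (eval y f1 - eval x f1) := by
  rw [← eval_one_restrictLine, restrictLine_polyF]
  simp [eval_one_restrictLine]

theorem eq_zero_of_map_add_mul_map_eq_zero {K L : Type*} [Field K] [Field L] (φ : K →+* L)
    {ξ : L} (hξ : ξ ∉ Set.range φ) {r s : K} (h : φ r + ξ * φ s = 0) : r = 0 ∧ s = 0 := by
  by_cases hs : s = 0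
  · subst hs
    simpa using h
  · refine absurd ⟨-r / s, ?_⟩ hξ
    have : φ s ≠ 0 := by simpa using hs
    rw [map_div₀, map_neg, div_eq_iff this]
    linear_combination -h

theorem exists_primitive_cube_root {K : Type*} [Field K] [Fintype K]
    (h : Fintype.card K % 3 = 1) : ∃ ω : K, ω ^ 3 = 1 ∧ ω ≠ 1 := by
  classical
  have hd : 3 ∣ Fintype.card Kˣ := by
    rw [Fintype.card_units]
    omega
  have : Fact (Nat.Prime 3) := ⟨Nat.prime_three⟩
  obtain ⟨w, hw⟩ := exists_prime_orderOf_dvd_card 3 hd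
  refine ⟨w, ?_, ?_⟩
  · rw [← Units.val_pow_eq_pow_val, ← hw, pow_orderOf_eq_one, Units.val_one]
  · rw [Ne, Units.val_eq_one, ← orderOf_eq_one_iff, hw]
    norm_num

/-- A binary quadratic form that vanishes at `(x, 1)` for every cube root of unity `x` is
zero. -/
theorem leading_coeff_eq_zero_of_cube_roots {K : Type*} [Field K] {ω : K} (h3 : ω ^ 3 = 1)
    (h1 : ω ≠ 1) {α β γ : K} (h : ∀ x : K, x ^ 3 = 1 → x ^ 2 * α + x * β + γ = 0) :
    α = 0 := by
  have hω : 1 + ω + ω ^ 2 = 0 := by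
    refine (mul_eq_zero.1 (?_ : (ω - 1) * (1 + ω + ω ^ 2) = 0)).resolve_left
      (sub_ne_zero.2 h1)
    linear_combination h3
  have three_ne : (3 : K) ≠ 0 := fun h => by
    apply h1
    have : (ω - 1) ^ 2 = 0 := by linear_combination hω - ω * h
    exact sub_eq_zero.1 (pow_eq_zero_iff two_ne_zero |>.1 this)
  have e1 := h 1 (one_pow 3)
  have e2 := h ω h3
  have e3 := h (ω ^ 2) (by rw [← pow_mul, mul_comm, pow_mul, h3, one_pow])
  refine (mul_eq_zero.1 (?_ : 3 * α = 0)).resolve_left three_ne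
  linear_combination e1 + ω * e2 + ω ^ 2 * e3 - (α * (ω ^ 3 + 2) + β * ω) * h3 -
    (β + γ) * hω

/-- Theorem 5.2 of the paper: for `p > 3`, `q ≡ 1 (mod 3)`, if `F` splits
into two quadrics switched by the Frobenius, then `O_7(f1,f2,f3)` is not an ovoid. -/
theorem statement3 {p h q : ℕ} (hp : p.Prime) (hp3 : 3 < p) (hqp : q = p ^ h)
    (hmod : q % 3 = 1)
    (hbound : (6.3 : ℝ) * (4 : ℝ) ^ ((13 : ℝ) / 3) < (q : ℝ))
    (Fq : Type*) [Field Fq] [Fintype Fq] (hcardq : Fintype.card Fq = q)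
    (L : Type*) [Field L] [Fintype L] [Algebra Fq L] (hcardL : Fintype.card L = q ^ 2)
    (f1 f2 f3 : MvPolynomial (Fin 3) Fq)
    (h01 : eval (fun _ => (0 : Fq)) f1 = 0)
    (h02 : eval (fun _ => (0 : Fq)) f2 = 0)
    (h03 : eval (fun _ => (0 : Fq)) f3 = 0)
    (hdeg : max (max f1.totalDegree f2.totalDegree) f3.totalDegree = 3)
    (hsplit : ∃ ξ : L, ξ ∉ Set.range (algebraMap Fq L) ∧
      ∃ R S : MvPolynomial (Fin 6) Fq,
        R.totalDegree ≤ 2 ∧ S.totalDegree ≤ 2 ∧ max R.totalDegree S.totalDegree = 2 ∧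
        MvPolynomial.map (algebraMap Fq L) (polyF f1 f2 f3) =
          (MvPolynomial.map (algebraMap Fq L) R + C ξ * MvPolynomial.map (algebraMap Fq L) S) *
            (MvPolynomial.map (algebraMap Fq L) R +
              C (ξ ^ q) * MvPolynomial.map (algebraMap Fq L) S)) :
    ¬ ovoidCondition (fun x y z => eval ![x, y, z] f1)
        (fun x y z => eval ![x, y, z] f2)
        (fun x y z => eval ![x, y, z] f3) := by
  obtain ⟨ξ, hξ, R, S, hR, hS, -, hF⟩ := hsplit
  set φ := algebraMap Fq L
  have hξq : ξ ^ q ∉ Set.range φ := by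
    rintro ⟨r, hr⟩
    refine hξ ⟨r, ?_⟩
    have h : (ξ ^ q) ^ q = ξ := by
      rw [← pow_mul, ← sq, ← hcardL, FiniteField.pow_card]
    have hrq : r ^ q = r := by rw [← hcardq, FiniteField.pow_card]
    rw [← h, ← hr, ← map_pow, hrq]
  have vanish {r s : Fq} (h : (φ r + ξ * φ s) * (φ r + ξ ^ q * φ s) = 0) :
      r = 0 ∧ s = 0 :=
    (mul_eq_zero.1 h).elim (eq_zero_of_map_add_mul_map_eq_zero φ hξ)
      (eq_zero_of_map_add_mul_map_eq_zero φ hξq)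
  have hline (a : Fin 6 → Fq) : (restrictLine a (polyF f1 f2 f3)).map φ =
      ((restrictLine a R).map φ + Polynomial.C ξ * (restrictLine a S).map φ) *
        ((restrictLine a R).map φ + Polynomial.C (ξ ^ q) * (restrictLine a S).map φ) := by
    have hC (z : L) : restrictLine (fun i => φ (a i)) (C z) = Polynomial.C z :=
      aeval_C _ z
    have := congrArg (restrictLine fun i => φ (a i)) hF
    simpa only [map_mul, map_add, restrictLine_map, hC] using this
  have heval (a : Fin 6 → Fq) : φ (eval a (polyF f1 f2 f3)) =
      (φ (eval a R) + ξ * φ (eval a S)) * (φ (eval a R) + ξ ^ q * φ (eval a S)) := by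
    have := congrArg (Polynomial.eval 1) (hline a)
    simpa [Polynomial.eval_one_map, eval_one_restrictLine] using this
  obtain ⟨B, ℓ, c, hB⟩ := exists_restrictLine_eq R hR
  obtain ⟨B', ℓ', c', hB'⟩ := exists_restrictLine_eq S hS
  have evalR (a : Fin 6 → Fq) : eval a R = B a a + ℓ a + c := by
    simp [← eval_one_restrictLine, hB]
  have evalS (a : Fin 6 → Fq) : eval a S = B' a a + ℓ' a + c' := by
    simp [← eval_one_restrictLine, hB']
  have hc : c = 0 ∧ c' = 0 := by
    have h0 : joinPoints (0 : Fin 3 → Fq) 0 = 0 := by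
      ext i
      fin_cases i <;> rfl
    have h := heval (joinPoints 0 0)
    rw [eval_joinPoints_polyF, evalR, evalS, h0] at h
    exact vanish (by simpa using h.symm)
  have hquad (u : Fin 3 → Fq) (x : Fq) (hx : x ^ 3 = 1) :
      B (joinPoints (fun i => x * u i) u) (joinPoints (fun i => x * u i) u) = 0 ∧
        B' (joinPoints (fun i => x * u i) u) (joinPoints (fun i => x * u i) u) = 0 := by
    have h := congrArg (fun g => Polynomial.coeff g 4) (hline (joinPoints (fun i => x * u i) u))
    simp only [Polynomial.coeff_map, coeff_four_restrictLine_polyF f1 f2 f3 hx, map_zero] at h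
    rw [hB, hB', show 4 = 2 + 2 from rfl,
      Polynomial.coeff_mul_add_eq_of_natDegree_le (by simp; compute_degree)
        (by simp; compute_degree)] at h
    exact vanish (by
      simpa [Polynomial.coeff_X, Polynomial.coeff_C, -map_pow] using h.symm)
  obtain ⟨ω, hω, hω1⟩ := exists_primitive_cube_root (K := Fq) (by rw [hcardq, hmod])
  have hzero (u : Fin 3 → Fq) : B (joinPoints u 0) (joinPoints u 0) = 0 ∧
      B' (joinPoints u 0) (joinPoints u 0) = 0 := by
    have expand (D : (Fin 6 → Fq) →ₗ[Fq] (Fin 6 → Fq) →ₗ[Fq] Fq)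
        (h : ∀ x : Fq, x ^ 3 = 1 →
          D (joinPoints (fun i => x * u i) u) (joinPoints (fun i => x * u i) u) = 0) :
        D (joinPoints u 0) (joinPoints u 0) = 0 := by
      refine leading_coeff_eq_zero_of_cube_roots hω hω1
        (β := D (joinPoints u 0) (joinPoints 0 u) + D (joinPoints 0 u) (joinPoints u 0))
        (γ := D (joinPoints 0 u) (joinPoints 0 u)) fun x hx => ?_
      rw [← h x hx, joinPoints_smul_self]
      simp only [map_add, map_smul, LinearMap.add_apply, LinearMap.smul_apply, smul_eq_mul]
      ring
    exact ⟨expand B fun x hx => (hquad u x hx).1, expand B' fun x hx => (hquad u x hx).2⟩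
  let J : (Fin 3 → Fq) →ₗ[Fq] Fin 6 → Fq :=
    { toFun := fun u => joinPoints u 0
      map_add' := fun u v => by
        ext i
        fin_cases i <;> simp [joinPoints]
      map_smul' := fun r u => by
        ext i
        fin_cases i <;> simp [joinPoints] }
  obtain ⟨u, hu, hu0⟩ := (Submodule.ne_bot_iff _).1 <|
    LinearMap.ker_ne_bot_of_finrank_lt (f := (ℓ ∘ₗ J).prod (ℓ' ∘ₗ J)) (by simp)
  obtain ⟨hℓ, hℓ'⟩ : ℓ (joinPoints u 0) = 0 ∧ ℓ' (joinPoints u 0) = 0 := by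
    simpa [J] using hu
  have hev := heval (joinPoints u 0)
  rw [evalR, evalS, hℓ, hℓ', (hzero u).1, (hzero u).2, hc.1, hc.2] at hev
  have hF0 : eval (joinPoints u 0) (polyF f1 f2 f3) = 0 := by simpa using hev
  rw [eval_joinPoints_polyF] at hF0
  intro hov
  refine hov (u 0) (u 1) (u 2) 0 0 0 (fun h => hu0 ?_) ?_
  · simp only [Prod.mk.injEq] at h
    ext i
    fin_cases i
    exacts [h.1, h.2.1, h.2.2]
  · have hu' : ![u 0, u 1, u 2] = u := by
      ext i
      fin_cases i <;> rfl
    have h0' : ![(0 : Fq), 0, 0] = 0 := by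
      ext i
      fin_cases i <;> rfl
    simpa only [hu', h0', Pi.zero_apply] using hF0
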